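/- arXiv:2603.13454 — 2 statements merged into one kernel-verified Lean document; each statement's English description precedes it below -/
import Mathlib

section
/- Let N ≥ 1 and let M₁, M₂ be N×N complex matrices. Then C(M₁) * (C(M₂) ⊗ I₂) * (I_N ⊗ W) = C(M₂) * (C(M₁) ⊗ I₂) * (I_N ⊗ W), up to the canonical re-indexing equivalences; i.e., two controlled matrices whose controls come from the two outputs of one W generator (targeting mutually exclusive sectors) commute past each other. -/
open Matrix
open scoped Kronecker

/-- The controlled matrix of an `N × N` complex matrix `M`. -/
noncomputable def ctrlMat {N : ℕ} (M : Matrix (Fin N) (Fin N) ℂ) :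
    Matrix (Fin N) (Fin N × Fin 2) ℂ :=
  fun i jb => if jb.2 = 0 then (if i = jb.1 then (1 : ℂ) else 0) else M i jb.1

/-- The W generator: `|0⟩ ↦ |00⟩`, `|1⟩ ↦ |01⟩ + |10⟩`. -/
noncomputable def Wmat : Matrix (Fin 2 × Fin 2) (Fin 2) ℂ :=
  fun ab c =>
    if c = 0 then (if ab = (0, 0) then 1 else 0)
    else if ab = (0, 1) ∨ ab = (1, 0) then 1 else 0

/-- Entries of the composite of two controlled matrices: the second control wire feeds `A`,
the first one feeds `B`. -/
theorem ctrlMat_mul_kronecker_one_apply {N : ℕ} (A B : Matrix (Fin N) (Fin N) ℂ)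
    (i l : Fin N) (a b : Fin 2) :
    (ctrlMat A * (ctrlMat B ⊗ₖ (1 : Matrix (Fin 2) (Fin 2) ℂ))) i ((l, a), b) =
      ∑ k, ctrlMat A i (k, b) * ctrlMat B k (l, a) := by
  simp [Matrix.mul_apply, Fintype.sum_prod_type, Matrix.kroneckerMap_apply, Matrix.one_apply]

/-- Precomposing with `I ⊗ V`, for `V` with one input wire and two output wires. -/
theorem mul_reindex_one_kronecker_apply {N : ℕ}
    (X : Matrix (Fin N) ((Fin N × Fin 2) × Fin 2) ℂ) (V : Matrix (Fin 2 × Fin 2) (Fin 2) ℂ)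
    (i l : Fin N) (c : Fin 2) :
    (X * Matrix.reindex (Equiv.prodAssoc (Fin N) (Fin 2) (Fin 2)).symm
        (Equiv.refl (Fin N × Fin 2)) ((1 : Matrix (Fin N) (Fin N) ℂ) ⊗ₖ V)) i (l, c) =
      ∑ a, ∑ b, X i ((l, a), b) * V (a, b) c := by
  simp only [Matrix.mul_apply, Fintype.sum_prod_type, Matrix.reindex_apply,
    Matrix.submatrix_apply, Matrix.kroneckerMap_apply, Matrix.one_apply, Equiv.symm_symm,
    Equiv.prodAssoc_apply, Equiv.refl_symm, Equiv.refl_apply]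
  rw [Finset.sum_eq_single l]
  · simp
  · intro k _ hk
    simp [hk]
  · simp

theorem stmt2 (N : ℕ) (hN : 1 ≤ N) (M₁ M₂ : Matrix (Fin N) (Fin N) ℂ) :
    ctrlMat M₁ * (ctrlMat M₂ ⊗ₖ (1 : Matrix (Fin 2) (Fin 2) ℂ)) *
      (Matrix.reindex (Equiv.prodAssoc (Fin N) (Fin 2) (Fin 2)).symm
        (Equiv.refl (Fin N × Fin 2))
        ((1 : Matrix (Fin N) (Fin N) ℂ) ⊗ₖ Wmat)) =
    ctrlMat M₂ * (ctrlMat M₁ ⊗ₖ (1 : Matrix (Fin 2) (Fin 2) ℂ)) *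
      (Matrix.reindex (Equiv.prodAssoc (Fin N) (Fin 2) (Fin 2)).symm
        (Equiv.refl (Fin N × Fin 2))
        ((1 : Matrix (Fin N) (Fin N) ℂ) ⊗ₖ Wmat)) := by
  ext i ⟨l, c⟩
  rw [mul_reindex_one_kronecker_apply, mul_reindex_one_kronecker_apply]
  simp only [ctrlMat_mul_kronecker_one_apply]
  fin_cases c
  · simp [Fin.sum_univ_two, ctrlMat, Wmat]
  · simp [Fin.sum_univ_two, ctrlMat, Wmat, add_comm]
end

section
/- Let n ≥ 1 and let ψ : (Fin n → Fin 2) → ℂ be an n-qubit state. Then coWₙ * (S(ψ) ⊗ (S(ψ) * diag(1,−1))) * W = S(0), up to the canonical re-indexing equivalences, where 0 is the zero state; i.e., postcomposing the control wire of the controlled state S(ψ) with the scalar gate diag(1,−1) yields an additive inverse of S(ψ) under the diagrammatic addition ⊞ of controlled states. -/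
open Matrix
open scoped Kronecker

/-- The controlled state of an `n`-qubit state `ψ`: column `0` is the standard basis
vector at the all-zeros bitstring, column `1` is `ψ`. -/
noncomputable def cstate {n : ℕ} (ψ : (Fin n → Fin 2) → ℂ) :
    Matrix (Fin n → Fin 2) (Fin 2) ℂ :=
  fun s b => if b = 0 then (if s = 0 then 1 else 0) else ψ s

/-- The `n`-fold merging map: `coWₙ s (u,v) = ∏ i, coW (s i) (u i, v i)` where `coW = Wᵀ`. -/
noncomputable def coWn (n : ℕ) :
    Matrix (Fin n → Fin 2) ((Fin n → Fin 2) × (Fin n → Fin 2)) ℂ :=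
  fun s uv => ∏ i, Wmat.transpose (s i) (uv.1 i, uv.2 i)

theorem Wmat_transpose_zero_left (s v : Fin 2) :
    Wmat.transpose s (0, v) = if s = v then 1 else 0 := by
  fin_cases s <;> fin_cases v <;> simp [Wmat]

theorem Wmat_transpose_zero_right (s u : Fin 2) :
    Wmat.transpose s (u, 0) = if s = u then 1 else 0 := by
  fin_cases s <;> fin_cases u <;> simp [Wmat]

/-- The all-zeros bitstring is a left unit for merging. -/
theorem coWn_zero_left {n : ℕ} (s v : Fin n → Fin 2) :
    coWn n s (0, v) = if s = v then 1 else 0 := by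
  simp [coWn, Wmat_transpose_zero_left, Finset.prod_ite_zero, funext_iff, -transpose_apply]

/-- The all-zeros bitstring is a right unit for merging. -/
theorem coWn_zero_right {n : ℕ} (s u : Fin n → Fin 2) :
    coWn n s (u, 0) = if s = u then 1 else 0 := by
  simp [coWn, Wmat_transpose_zero_right, Finset.prod_ite_zero, funext_iff, -transpose_apply]

theorem cstate_mul_diag {n : ℕ} (ψ : (Fin n → Fin 2) → ℂ) (s : Fin n → Fin 2) (b : Fin 2) :
    (cstate ψ * !![(1 : ℂ), 0; 0, -1]) s b =
      if b = 0 then (if s = 0 then 1 else 0) else -ψ s := by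
  fin_cases b <;> simp [Matrix.mul_apply, cstate]

theorem stmt10 (n : ℕ) (hn : 1 ≤ n) (ψ : (Fin n → Fin 2) → ℂ) :
    coWn n * (cstate ψ ⊗ₖ (cstate ψ * !![(1 : ℂ), 0; 0, -1])) * Wmat =
    cstate (0 : (Fin n → Fin 2) → ℂ) := by
  rw [Matrix.mul_assoc]
  ext s c
  rw [Matrix.mul_apply, Fintype.sum_prod_type]
  have hW : ∀ u v, ((cstate ψ ⊗ₖ (cstate ψ * !![(1 : ℂ), 0; 0, -1])) * Wmat) (u, v) c =
      if c = 0 then (if u = 0 then (if v = 0 then 1 else 0) else 0)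
      else (if u = 0 then -ψ v else 0) + (if v = 0 then ψ u else 0) := by
    intro u v
    rw [Matrix.mul_apply, Fintype.sum_prod_type]
    simp only [kroneckerMap_apply, cstate_mul_diag]
    fin_cases c <;> by_cases hu : u = 0 <;> simp [cstate, Wmat, hu]
  simp only [hW]
  by_cases hc : c = 0
  · simp [hc, cstate, coWn_zero_left]
  · simp [hc, cstate, mul_add, Finset.sum_add_distrib, coWn_zero_left, coWn_zero_right]
end
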